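/- arXiv:2605.04308 — 2 statements merged into one kernel-verified Lean document; each statement's English description precedes it below -/
import Mathlib

section
/- Let E be a real T × d matrix with largest singular value σ_max(E), let c ∈ (0,1) and L > 0, and let f : ℝ^d → ℝ^T satisfy ‖f(x) − f(y)‖₁ ≤ L·‖x − y‖₂ for all x, y ∈ ℝ^d, with every coordinate of f taking values in {0} ∪ [c,1]. Let w be a probability vector on Fin T, and let α, α' ∈ ℝ^T be such that f(Eᵀα)_k > 0 and f(Eᵀα')_k > 0 whenever w_k > 0. Then |Σ_{k : w_k > 0} w_k·(log f(Eᵀα)_k − log f(Eᵀα')_k)| ≤ (L·σ_max(E)/c)·‖α − α'‖₂. -/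
lemma log_sub_le_aux {a b c : ℝ} (hc : 0 < c) (ha : 0 < a) (hb : c ≤ b) :
    Real.log a - Real.log b ≤ |a - b| / c := by
  have hb0 : 0 < b := lt_of_lt_of_le hc hb
  rw [← Real.log_div ha.ne' hb0.ne']
  have h1 := Real.log_le_sub_one_of_pos (div_pos ha hb0)
  have h2 : a / b - 1 = (a - b) / b := by field_simp
  have h3 : (a - b) / b ≤ |a - b| / b := by gcongr; exact le_abs_self _
  have h4 : |a - b| / b ≤ |a - b| / c := by gcongr
  linarith

/-- Lipschitz bound on the log-loss in the representation vector `α` (from the proof of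
Theorem 3.2): if `f : ℝ^d → ℝ^T` is `L`-Lipschitz from `ℓ2` to `ℓ1`, takes coordinate
values in `{0} ∪ [c,1]`, `σ` bounds the largest singular value of `E` (as an
`ℓ2 → ℓ2` operator bound for `Eᵀ`), and `w` is a probability vector with
`f(Eᵀα), f(Eᵀα')` positive on the support of `w`, then
`|Σ_{k : w k > 0} w k (log f(Eᵀα)_k − log f(Eᵀα')_k)| ≤ (L σ / c) ‖α − α'‖₂`. -/
theorem stmt_8 {T d : ℕ} (E : Matrix (Fin T) (Fin d) ℝ) (σ : ℝ)
    (hσ : ∀ α : Fin T → ℝ,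
      Real.sqrt (∑ j, (E.transpose.mulVec α j) ^ 2) ≤ σ * Real.sqrt (∑ k, (α k) ^ 2))
    (c : ℝ) (hc0 : 0 < c) (hc1 : c < 1) (L : ℝ) (hL : 0 < L)
    (f : (Fin d → ℝ) → Fin T → ℝ)
    (hLip : ∀ x y : Fin d → ℝ, ∑ k, |f x k - f y k| ≤ L * Real.sqrt (∑ j, (x j - y j) ^ 2))
    (hrange : ∀ x k, f x k = 0 ∨ (c ≤ f x k ∧ f x k ≤ 1))
    (w : Fin T → ℝ) (hw0 : ∀ k, 0 ≤ w k) (hw1 : ∑ k, w k = 1)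
    (α α' : Fin T → ℝ)
    (hα : ∀ k, 0 < w k → 0 < f (E.transpose.mulVec α) k)
    (hα' : ∀ k, 0 < w k → 0 < f (E.transpose.mulVec α') k) :
    |∑ k ∈ Finset.univ.filter fun k => 0 < w k,
        w k * (Real.log (f (E.transpose.mulVec α) k) - Real.log (f (E.transpose.mulVec α') k))|
      ≤ L * σ / c * Real.sqrt (∑ k, (α k - α' k) ^ 2) := by
  set x := E.transpose.mulVec α with hx
  set y := E.transpose.mulVec α' with hy
  have hlow : ∀ z k, 0 < f z k → c ≤ f z k := by
    intro z k h
    rcases hrange z k with h0 | h0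
    · linarith
    · exact h0.1
  have hw_le : ∀ k, w k ≤ 1 := fun k => by
    rw [← hw1]
    exact Finset.single_le_sum (fun i _ => hw0 i) (Finset.mem_univ k)
  have hterm : ∀ k ∈ Finset.univ.filter (fun k => 0 < w k),
      |w k * (Real.log (f x k) - Real.log (f y k))| ≤ |f x k - f y k| / c := by
    intro k hk
    have hk' : 0 < w k := (Finset.mem_filter.mp hk).2
    have h1 := log_sub_le_aux hc0 (hα k hk') (hlow _ _ (hα' k hk'))
    have h2 := log_sub_le_aux hc0 (hα' k hk') (hlow _ _ (hα k hk'))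
    rw [abs_sub_comm] at h2
    have h3 : |Real.log (f x k) - Real.log (f y k)| ≤ |f x k - f y k| / c :=
      abs_le.mpr ⟨by linarith, h1⟩
    rw [abs_mul, abs_of_pos hk']
    calc w k * |Real.log (f x k) - Real.log (f y k)|
        ≤ 1 * |Real.log (f x k) - Real.log (f y k)| :=
          mul_le_mul_of_nonneg_right (hw_le k) (abs_nonneg _)
      _ ≤ _ := by rw [one_mul]; exact h3
  have hE : Real.sqrt (∑ j, (x j - y j) ^ 2) ≤ σ * Real.sqrt (∑ k, (α k - α' k) ^ 2) := by
    have h := hσ (α - α')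
    rw [Matrix.mulVec_sub] at h
    exact h
  calc _ ≤ ∑ k ∈ Finset.univ.filter (fun k => 0 < w k),
        |w k * (Real.log (f x k) - Real.log (f y k))| := Finset.abs_sum_le_sum_abs _ _
    _ ≤ ∑ k ∈ Finset.univ.filter (fun k => 0 < w k), |f x k - f y k| / c :=
        Finset.sum_le_sum hterm
    _ ≤ ∑ k, |f x k - f y k| / c :=
        Finset.sum_le_sum_of_subset_of_nonneg (Finset.filter_subset _ _)
          (fun i _ _ => by positivity)
    _ = (∑ k, |f x k - f y k|) / c := by rw [Finset.sum_div]
    _ ≤ (L * (σ * Real.sqrt (∑ k, (α k - α' k) ^ 2))) / c := by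
        have h := (hLip x y).trans (mul_le_mul_of_nonneg_left hE hL.le)
        exact div_le_div_of_nonneg_right h hc0.le
    _ = _ := by ring
end

section
/- Let E be a real T × d matrix with largest singular value σ_max(E), let c ∈ (0,1), L > 0, B > 0, 1 ≤ s ≤ T, and let f : ℝ^d → ℝ^T satisfy ‖f(x) − f(y)‖₁ ≤ L·‖x − y‖₂ with every coordinate of f taking values in {0} ∪ [c,1] and with f(Eᵀα) a probability vector for every α. Let q* be a probability vector on Fin T and let z_1, …, z_n be i.i.d. random variables with law q*. Let A'' = {α ∈ ℝ^T : ‖α‖₀ ≤ s, ‖α‖₂ ≤ B, and f(Eᵀα)_k ≥ c whenever q*_k > 0}, and for α ∈ A'' define the empirical loss ℓ̂(α) = (1/n)·Σ_{i=1}^n (−log f(Eᵀα)_{z_i}) and the population loss ℓ(α) = Σ_{k : q*_k > 0} q*_k·(−log f(Eᵀα)_k). Let L̃ = L·σ_max(E)/c and let M be any number such that the set {α ∈ ℝ^T : ‖α‖₀ ≤ s, ‖α‖₂ ≤ B} admits an η-net in ℓ2 of cardinality at most M. Then for all t > 0 and η > 0, P( sup_{α ∈ A''} |ℓ̂(α)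 − ℓ(α)| ≥ t + 2·L̃·η ) ≤ 2·M·exp(−2·n·t²/(log c)²). -/
open MeasureTheory ProbabilityTheory

/-- The set of `s`-sparse vectors in `ℝ^T` of Euclidean norm at most `B`. -/
def sparseBall (T s : ℕ) (B : ℝ) : Set (Fin T → ℝ) :=
  {α | (Finset.univ.filter fun k => α k ≠ 0).card ≤ s ∧ Real.sqrt (∑ k, (α k) ^ 2) ≤ B}

lemma aux_cont {T d : ℕ} (L : ℝ) (f : (Fin d → ℝ) → Fin T → ℝ)
    (hLip : ∀ x y : Fin d → ℝ, ∑ k, |f x k - f y k| ≤ L * Real.sqrt (∑ j, (x j - y j) ^ 2))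
    (k : Fin T) : Continuous fun x => f x k := by
  rw [continuous_iff_continuousAt]
  intro x
  rw [ContinuousAt, tendsto_iff_dist_tendsto_zero]
  have h1 : Filter.Tendsto (fun y : Fin d → ℝ => L * Real.sqrt (∑ j, (y j - x j) ^ 2))
      (nhds x) (nhds 0) := by
    have : Continuous (fun y : Fin d → ℝ => L * Real.sqrt (∑ j, (y j - x j) ^ 2)) := by
      fun_prop
    simpa using this.tendsto x
  refine squeeze_zero (fun _ => dist_nonneg) (fun y => ?_) h1
  rw [Real.dist_eq]
  exact (Finset.single_le_sum (f := fun k => |f y k - f x k|) (fun _ _ => abs_nonneg _)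
    (Finset.mem_univ k)).trans (hLip y x)

lemma aux_dich {T d : ℕ} (L c : ℝ) (hc0 : 0 < c) (f : (Fin d → ℝ) → Fin T → ℝ)
    (hLip : ∀ x y : Fin d → ℝ, ∑ k, |f x k - f y k| ≤ L * Real.sqrt (∑ j, (x j - y j) ^ 2))
    (hrange : ∀ x k, f x k = 0 ∨ (c ≤ f x k ∧ f x k ≤ 1))
    (k : Fin T) (x y : Fin d → ℝ) (hx : f x k = 0) : f y k = 0 := by
  rcases hrange y k with h | h
  · exact h
  · obtain ⟨w, hw⟩ := mem_range_of_exists_le_of_exists_ge (c := c / 2) (aux_cont L f hLip k)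
      ⟨x, by simp only [hx]; positivity⟩ ⟨y, by linarith [h.1]⟩
    simp only at hw
    rcases hrange w k with h' | h'
    · rw [h'] at hw; linarith
    · rw [hw] at h'; linarith [h'.1]

lemma aux_log (c x y : ℝ) (hc0 : 0 < c) (hx : c ≤ x) (hy : c ≤ y) :
    Real.log x - Real.log y ≤ |x - y| / c := by
  have hx0 : 0 < x := by linarith
  have hy0 : 0 < y := by linarith
  rw [← Real.log_div hx0.ne' hy0.ne']
  have h1 := Real.log_le_sub_one_of_pos (div_pos hx0 hy0)
  have h2 : x / y - 1 = (x - y) / y := by field_simp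
  rw [h2] at h1
  calc _ ≤ (x - y) / y := h1
    _ ≤ |x - y| / y := by gcongr; exact le_abs_self _
    _ ≤ |x - y| / c := by gcongr

lemma aux_loglip {T d : ℕ} (L c : ℝ) (hc0 : 0 < c) (f : (Fin d → ℝ) → Fin T → ℝ)
    (hLip : ∀ x y : Fin d → ℝ, ∑ k, |f x k - f y k| ≤ L * Real.sqrt (∑ j, (x j - y j) ^ 2))
    (hrange : ∀ x k, f x k = 0 ∨ (c ≤ f x k ∧ f x k ≤ 1))
    (k : Fin T) (x y : Fin d → ℝ) :
    |(-Real.log (f x k)) - (-Real.log (f y k))|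
      ≤ L * Real.sqrt (∑ j, (x j - y j) ^ 2) / c := by
  have hk : |f x k - f y k| ≤ L * Real.sqrt (∑ j, (x j - y j) ^ 2) :=
    (Finset.single_le_sum (f := fun k => |f x k - f y k|) (fun _ _ => abs_nonneg _)
      (Finset.mem_univ k)).trans (hLip x y)
  have hk' : |f x k - f y k| / c ≤ L * Real.sqrt (∑ j, (x j - y j) ^ 2) / c := by gcongr
  refine le_trans ?_ hk'
  rcases hrange x k with h | h
  · rw [h, aux_dich L c hc0 f hLip hrange k x y h]; simp
  rcases hrange y k with h' | h'
  · rw [h', aux_dich L c hc0 f hLip hrange k y x h']; simp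
  have h1 := aux_log c _ _ hc0 h.1 h'.1
  have h2 := aux_log c _ _ hc0 h'.1 h.1
  rw [abs_sub_comm] at h2
  rw [abs_le]; constructor <;> linarith

lemma aux_mean {Ω : Type*} [MeasurableSpace Ω] (μ : Measure Ω) [IsProbabilityMeasure μ]
    {T : ℕ} (qstar : Fin T → ℝ) (hq0 : ∀ k, 0 ≤ qstar k)
    (z : Ω → Fin T) (hmeas : Measurable z)
    (hlaw : ∀ (k : Fin T), μ {ω | z ω = k} = ENNReal.ofReal (qstar k))
    (g : Fin T → ℝ) : ∫ ω, g (z ω) ∂μ = ∑ k, qstar k * g k := by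
  have : IsProbabilityMeasure (μ.map z) := Measure.isProbabilityMeasure_map hmeas.aemeasurable
  rw [← integral_map (f := g) hmeas.aemeasurable (Measurable.of_discrete).aestronglyMeasurable,
    integral_fintype (Integrable.of_finite)]
  refine Finset.sum_congr rfl fun k _ => ?_
  rw [measureReal_def, Measure.map_apply hmeas (measurableSet_singleton k)]
  have : z ⁻¹' {k} = {ω | z ω = k} := rfl
  rw [this, hlaw, ENNReal.toReal_ofReal (hq0 k), smul_eq_mul]

lemma aux_hoeff1 {Ω : Type*} [MeasurableSpace Ω] (μ : Measure Ω) [IsProbabilityMeasure μ]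
    {T n : ℕ} (hn : 0 < n) (qstar : Fin T → ℝ) (hq0 : ∀ k, 0 ≤ qstar k)
    (z : Fin n → Ω → Fin T) (hmeas : ∀ i, Measurable (z i))
    (hindep : iIndepFun z μ)
    (hlaw : ∀ (i : Fin n) (k : Fin T), μ {ω | z i ω = k} = ENNReal.ofReal (qstar k))
    (g : Fin T → ℝ) (a b : ℝ) (hg : ∀ k, g k ∈ Set.Icc a b) (t : ℝ) (ht : 0 < t) :
    μ.real {ω | t ≤ (1 / n) * ∑ i, g (z i ω) - ∑ k, qstar k * g k}
      ≤ Real.exp (-(2 * n * t ^ 2) / (b - a) ^ 2) := by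
  have hn' : (0 : ℝ) < n := by exact_mod_cast hn
  set m := ∑ k, qstar k * g k with hm
  have hX : ∀ i, HasSubgaussianMGF (fun ω => g (z i ω) - m) ((‖b - a‖₊ / 2) ^ 2) μ := by
    intro i
    have := hasSubgaussianMGF_of_mem_Icc (μ := μ) (X := fun ω => g (z i ω)) (a := a) (b := b)
      ((Measurable.of_discrete (f := g)).comp (hmeas i)).aemeasurable
      (Filter.Eventually.of_forall fun ω => hg _)
    rwa [aux_mean μ qstar hq0 (z i) (hmeas i) (hlaw i) g] at this
  have hind : iIndepFun (fun i ω => g (z i ω) - m) μ :=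
    hindep.comp (fun _ k => g k - m) (fun _ => Measurable.of_discrete)
  have key := HasSubgaussianMGF.measure_sum_ge_le_of_iIndepFun hind (s := Finset.univ)
    (fun i _ => hX i) (ε := n * t) (by positivity)
  have hset : {ω | t ≤ (1 / n) * ∑ i, g (z i ω) - m}
      = {ω | (n : ℝ) * t ≤ ∑ i, (g (z i ω) - m)} := by
    ext ω
    simp only [Set.mem_ofPred_eq, Finset.sum_sub_distrib, Finset.sum_const, Finset.card_univ,
      Fintype.card_fin, nsmul_eq_mul]
    rw [← mul_le_mul_iff_right₀ hn', mul_sub, ← mul_assoc, mul_one_div_cancel hn'.ne', one_mul]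
  rw [hset]
  refine key.trans (le_of_eq ?_)
  congr 1
  simp only [Finset.sum_const, Finset.card_univ, Fintype.card_fin, nsmul_eq_mul]
  push_cast
  rw [Real.norm_eq_abs, div_pow, sq_abs]
  rcases eq_or_ne (b - a) 0 with h | h
  · simp [h]
  · field_simp

lemma aux_hoeff2 {Ω : Type*} [MeasurableSpace Ω] (μ : Measure Ω) [IsProbabilityMeasure μ]
    {T n : ℕ} (qstar : Fin T → ℝ) (hq0 : ∀ k, 0 ≤ qstar k)
    (z : Fin n → Ω → Fin T) (hmeas : ∀ i, Measurable (z i))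
    (hindep : iIndepFun z μ)
    (hlaw : ∀ (i : Fin n) (k : Fin T), μ {ω | z i ω = k} = ENNReal.ofReal (qstar k))
    (g : Fin T → ℝ) (b : ℝ) (hg : ∀ k, g k ∈ Set.Icc 0 b) (t : ℝ) (ht : 0 < t) :
    μ.real {ω | t ≤ |(1 / n) * ∑ i, g (z i ω) - ∑ k, qstar k * g k|}
      ≤ 2 * Real.exp (-(2 * n * t ^ 2) / b ^ 2) := by
  rcases Nat.eq_zero_or_pos n with hn | hn
  · subst hn
    refine measureReal_le_one.trans ?_
    simp
  have h1 := aux_hoeff1 μ hn qstar hq0 z hmeas hindep hlaw g 0 b hg t ht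
  have h2 := aux_hoeff1 μ hn qstar hq0 z hmeas hindep hlaw (fun k => - g k) (-b) 0
    (fun k => ⟨by linarith [(hg k).2], by linarith [(hg k).1]⟩) t ht
  have hsub : {ω | t ≤ |(1 / n) * ∑ i, g (z i ω) - ∑ k, qstar k * g k|} ⊆
      {ω | t ≤ (1 / n) * ∑ i, g (z i ω) - ∑ k, qstar k * g k} ∪
      {ω | t ≤ (1 / n) * ∑ i, -g (z i ω) - ∑ k, qstar k * -g k} := by
    intro ω hω
    simp only [Set.mem_ofPred_eq, Set.mem_union, Finset.sum_neg_distrib, mul_neg] at hω ⊢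
    rcases le_abs.1 hω with h | h
    · left; exact h
    · right; linarith
  have h3 := (measureReal_mono (μ := μ) hsub).trans (measureReal_union_le _ _)
  simp only [sub_zero, zero_sub, neg_neg] at h1 h2
  linarith

/-- Uniform deviation bound (Step 2 of the proof of Theorem 3.2): over the feasible set
`A'' = {α : ‖α‖₀ ≤ s, ‖α‖₂ ≤ B, f(Eᵀα)_k ≥ c on the support of q*}`, with `z 1,…,z n`
i.i.d. with law `q*`, empirical loss `ℓ̂(α) = (1/n) Σ_i −log f(Eᵀα)_{z_i}` and population
loss `ℓ(α) = Σ_k q*_k (−log f(Eᵀα)_k)`, and `M` bounding the cardinality of an `η`-net of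
the sparse ball, we have
`P(sup_{α ∈ A''} |ℓ̂(α) − ℓ(α)| ≥ t + 2 L̃ η) ≤ 2 M exp(−2 n t² / (log c)²)`. -/
theorem stmt_10
    {Ω : Type*} [MeasurableSpace Ω] (μ : Measure Ω) [IsProbabilityMeasure μ]
    {T d n : ℕ} (E : Matrix (Fin T) (Fin d) ℝ) (σ : ℝ)
    (hσ : ∀ α : Fin T → ℝ,
      Real.sqrt (∑ j, (E.transpose.mulVec α j) ^ 2) ≤ σ * Real.sqrt (∑ k, (α k) ^ 2))
    (c : ℝ) (hc0 : 0 < c) (hc1 : c < 1) (L : ℝ) (hL : 0 < L)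
    (B : ℝ) (hB : 0 < B) (s : ℕ) (hs1 : 1 ≤ s) (hsT : s ≤ T)
    (f : (Fin d → ℝ) → Fin T → ℝ)
    (hLip : ∀ x y : Fin d → ℝ, ∑ k, |f x k - f y k| ≤ L * Real.sqrt (∑ j, (x j - y j) ^ 2))
    (hrange : ∀ x k, f x k = 0 ∨ (c ≤ f x k ∧ f x k ≤ 1))
    (hfprob : ∀ α : Fin T → ℝ, ∑ k, f (E.transpose.mulVec α) k = 1)
    (qstar : Fin T → ℝ) (hq0 : ∀ k, 0 ≤ qstar k) (hq1 : ∑ k, qstar k = 1)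
    (z : Fin n → Ω → Fin T) (hmeas : ∀ i, Measurable (z i))
    (hindep : iIndepFun z μ)
    (hlaw : ∀ (i : Fin n) (k : Fin T), μ {ω | z i ω = k} = ENNReal.ofReal (qstar k))
    (M η t : ℝ) (hη : 0 < η) (ht : 0 < t)
    (hnet : ∃ S : Finset (Fin T → ℝ), (S.card : ℝ) ≤ M ∧
      ∀ α ∈ sparseBall T s B, ∃ β ∈ S, Real.sqrt (∑ k, (α k - β k) ^ 2) ≤ η) :
    (μ {ω | t + 2 * (L * σ / c) * η ≤
        ⨆ α ∈ {a ∈ sparseBall T s B |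
            ∀ k, 0 < qstar k → c ≤ f (E.transpose.mulVec a) k},
          |(1 / n) * ∑ i, -Real.log (f (E.transpose.mulVec α) (z i ω))
            - ∑ k ∈ Finset.univ.filter fun k => 0 < qstar k,
                qstar k * -Real.log (f (E.transpose.mulVec α) k)|}).toReal
      ≤ 2 * M * Real.exp (-(2 * n * t ^ 2) / (Real.log c) ^ 2) := by
  classical
  obtain ⟨S, hSM, hS⟩ := hnet
  have hT : 0 < T := by omega
  have hσ0 : 0 ≤ σ := by
    have h := (Real.sqrt_nonneg _).trans (hσ (Pi.single ⟨0, hT⟩ 1))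
    have h1 : ∑ k, ((Pi.single ⟨0, hT⟩ 1 : Fin T → ℝ) k) ^ 2 = 1 := by
      rw [Finset.sum_eq_single (⟨0, hT⟩ : Fin T)]
      · simp
      · intro b _ hb; simp [Pi.single_eq_of_ne hb]
      · simp
    rw [h1] at h
    simpa using h
  set g : (Fin T → ℝ) → Fin T → ℝ := fun α k => -Real.log (f (E.transpose.mulVec α) k) with hg
  have hgr : ∀ α k, g α k ∈ Set.Icc 0 (-Real.log c) := by
    intro α k
    have hlc : Real.log c < 0 := Real.log_neg hc0 hc1
    simp only [hg]
    rcases hrange (E.transpose.mulVec α) k with h | h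
    · rw [h]; simp; exact hlc.le
    · have h1 := Real.log_le_log hc0 h.1
      have h2 := Real.log_nonpos (hc0.le.trans h.1) h.2
      exact ⟨by linarith, by linarith⟩
  have hpop : ∀ α, ∑ k ∈ Finset.univ.filter (fun k => 0 < qstar k), qstar k * g α k
      = ∑ k, qstar k * g α k := by
    intro α
    refine Finset.sum_filter_of_ne fun k _ hk => ?_
    exact lt_of_le_of_ne (hq0 k) (fun h => hk (by rw [← h, zero_mul]))
  set K : ℝ := L * σ / c * η with hK
  have hK0 : 0 ≤ K := by positivity
  have hglip : ∀ α β : Fin T → ℝ, Real.sqrt (∑ k, (α k - β k) ^ 2) ≤ η →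
      ∀ k, |g α k - g β k| ≤ K := by
    intro α β hαβ k
    refine (aux_loglip L c hc0 f hLip hrange k _ _).trans ?_
    have h1 := hσ (α - β)
    rw [Matrix.mulVec_sub] at h1
    simp only [Pi.sub_apply] at h1
    have h2 : L * Real.sqrt (∑ j, (E.transpose.mulVec α j - E.transpose.mulVec β j) ^ 2)
        ≤ L * (σ * η) := by
      gcongr
      exact h1.trans (by gcongr)
    calc _ ≤ L * (σ * η) / c := by gcongr
      _ = K := by rw [hK]; ring
  set D : (Fin T → ℝ) → Ω → ℝ := fun α ω =>
    |(1 / n) * ∑ i, g α (z i ω) - ∑ k, qstar k * g α k| with hD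
  have hDlip : ∀ α β : Fin T → ℝ, Real.sqrt (∑ k, (α k - β k) ^ 2) ≤ η →
      ∀ ω, D α ω ≤ D β ω + 2 * K := by
    intro α β hαβ ω
    have hk := hglip α β hαβ
    have e1 : |(1 / n : ℝ) * ∑ i, g α (z i ω) - (1 / n) * ∑ i, g β (z i ω)| ≤ K := by
      rw [← mul_sub, ← Finset.sum_sub_distrib, abs_mul]
      have : |∑ i, (g α (z i ω) - g β (z i ω))| ≤ n * K := by
        refine (Finset.abs_sum_le_sum_abs _ _).trans ?_
        refine (Finset.sum_le_sum fun i _ => hk (z i ω)).trans ?_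
        simp
      rcases Nat.eq_zero_or_pos n with hn | hn
      · subst hn; simpa using hK0
      · have hn' : (0 : ℝ) < n := by exact_mod_cast hn
        rw [abs_of_pos (by positivity)]
        calc _ ≤ 1 / (n : ℝ) * (n * K) := by gcongr
          _ = K := by field_simp
    have e2 : |∑ k, qstar k * g α k - ∑ k, qstar k * g β k| ≤ K := by
      rw [← Finset.sum_sub_distrib]
      refine (Finset.abs_sum_le_sum_abs _ _).trans ?_
      calc _ ≤ ∑ k, qstar k * K := by
            refine Finset.sum_le_sum fun k _ => ?_
            rw [← mul_sub, abs_mul, abs_of_nonneg (hq0 k)]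
            exact mul_le_mul_of_nonneg_left (hk k) (hq0 k)
        _ = K := by rw [← Finset.sum_mul, hq1, one_mul]
    simp only [hD]
    have e3 := abs_le.1 e1
    have e4 := abs_le.1 e2
    have e5 := le_abs_self ((1 / n : ℝ) * ∑ i, g β (z i ω) - ∑ k, qstar k * g β k)
    have e6 := neg_abs_le ((1 / n : ℝ) * ∑ i, g β (z i ω) - ∑ k, qstar k * g β k)
    rw [abs_le]; constructor <;> linarith [e3.1, e3.2, e4.1, e4.2]
  have hSne : S.Nonempty := by
    obtain ⟨β, hβ, _⟩ := hS 0 (by simp [sparseBall, hB.le])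
    exact ⟨β, hβ⟩
  have hsub : {ω | t + 2 * (L * σ / c) * η ≤
        ⨆ α ∈ {a ∈ sparseBall T s B |
            ∀ k, 0 < qstar k → c ≤ f (E.transpose.mulVec a) k},
          |(1 / n) * ∑ i, -Real.log (f (E.transpose.mulVec α) (z i ω))
            - ∑ k ∈ Finset.univ.filter fun k => 0 < qstar k,
                qstar k * -Real.log (f (E.transpose.mulVec α) k)|}
      ⊆ ⋃ β ∈ S, {ω | t ≤ D β ω} := by
    intro ω hω
    by_contra hcon
    simp only [Set.mem_iUnion, Set.mem_ofPred_eq, not_exists, not_le] at hcon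
    obtain ⟨β0, hβ0, hmax⟩ := S.exists_max_image (fun β => D β ω) hSne
    have hle : (⨆ α ∈ {a ∈ sparseBall T s B |
            ∀ k, 0 < qstar k → c ≤ f (E.transpose.mulVec a) k},
          |(1 / n) * ∑ i, -Real.log (f (E.transpose.mulVec α) (z i ω))
            - ∑ k ∈ Finset.univ.filter fun k => 0 < qstar k,
                qstar k * -Real.log (f (E.transpose.mulVec α) k)|) ≤ D β0 ω + 2 * K := by
      have hnn : 0 ≤ D β0 ω + 2 * K := by
        have : 0 ≤ D β0 ω := abs_nonneg _
        linarith
      refine Real.iSup_le (fun α => Real.iSup_le (fun hα => ?_) hnn) hnn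
      obtain ⟨β, hβ, hαβ⟩ := hS α hα.1
      have h1 := hDlip α β hαβ ω
      have h2 := hmax β hβ
      have h3 := hpop α
      simp only [hD, hg] at h1 h2 h3 ⊢
      rw [h3]
      linarith
    have h1 := hcon β0 hβ0
    have h2 : t + 2 * (L * σ / c) * η ≤ D β0 ω + 2 * K := le_trans hω hle
    rw [hK] at h2
    linarith
  have hfin := measureReal_mono (μ := μ) hsub (measure_ne_top _ _)
  have hb := measureReal_biUnion_finset_le (μ := μ) S (fun β => {ω | t ≤ D β ω})
  rw [← measureReal_def]
  refine hfin.trans (hb.trans ?_)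
  calc _ ≤ ∑ β ∈ S, 2 * Real.exp (-(2 * n * t ^ 2) / (-Real.log c) ^ 2) :=
        Finset.sum_le_sum fun β _ =>
          aux_hoeff2 μ qstar hq0 z hmeas hindep hlaw (g β) _ (hgr β) t ht
    _ = S.card * (2 * Real.exp (-(2 * n * t ^ 2) / (Real.log c) ^ 2)) := by
        rw [Finset.sum_const, nsmul_eq_mul, neg_sq]
    _ ≤ M * (2 * Real.exp (-(2 * n * t ^ 2) / (Real.log c) ^ 2)) := by gcongr
    _ = _ := by ring
end
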